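/- Let Γ = (Σ₁, Σ₂; P₁, P₂) be a two-person game with payoffs bounded below in the co-player's variable. If (σ₁*, σ₂*) is a semi-strict Nash equilibrium of Γ, then (σ₁*, σ₂*) is a semi-strict Nash equilibrium of the flat game Γ♭ = (Σ₁, Σ₂; P♭₁, P♭₂). -/

import Mathlib

/-- Lower payoff of player 1:
`P♭₁(σ₁,σ₂) = inf { P₁(σ₁,τ) : τ, P₂(σ₁,τ) ≥ P₂(σ₁,σ₂) }`. -/
noncomputable def flat1 {X Y : Type} (P1 P2 : X → Y → ℝ) (σ1 : X) (σ2 : Y) : ℝ :=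
  sInf {v : ℝ | ∃ τ : Y, P2 σ1 σ2 ≤ P2 σ1 τ ∧ P1 σ1 τ = v}

/-- Lower payoff of player 2:
`P♭₂(σ₁,σ₂) = inf { P₂(τ,σ₂) : τ, P₁(τ,σ₂) ≥ P₁(σ₁,σ₂) }`. -/
noncomputable def flat2 {X Y : Type} (P1 P2 : X → Y → ℝ) (σ1 : X) (σ2 : Y) : ℝ :=
  sInf {v : ℝ | ∃ τ : X, P1 σ1 σ2 ≤ P1 τ σ2 ∧ P2 τ σ2 = v}

/-- Nash equilibrium of the two-person game `(X, Y; P1, P2)`. -/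
def IsNE {X Y : Type} (P1 P2 : X → Y → ℝ) (s : X × Y) : Prop :=
  (∀ σ1 : X, P1 σ1 s.2 ≤ P1 s.1 s.2) ∧ (∀ σ2 : Y, P2 s.1 σ2 ≤ P2 s.1 s.2)

/-- Semi-strict Nash equilibrium. -/
def IsSSNE {X Y : Type} (P1 P2 : X → Y → ℝ) (s : X × Y) : Prop :=
  IsNE P1 P2 s ∧
  (∀ σ1 : X, P1 σ1 s.2 = P1 s.1 s.2 → P2 σ1 s.2 = P2 s.1 s.2) ∧
  (∀ σ2 : Y, P2 s.1 σ2 = P2 s.1 s.2 → P1 s.1 σ2 = P1 s.1 s.2)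

theorem flat1_le {X Y : Type} {P1 P2 : X → Y → ℝ} {σ1 : X}
    (hB : BddBelow (Set.range fun σ2 : Y => P1 σ1 σ2)) (σ2 : Y) :
    flat1 P1 P2 σ1 σ2 ≤ P1 σ1 σ2 :=
  csInf_le (hB.mono (by rintro _ ⟨τ, _, h⟩; exact ⟨τ, h⟩)) ⟨σ2, le_rfl, rfl⟩

theorem flat2_le {X Y : Type} {P1 P2 : X → Y → ℝ} {σ2 : Y}
    (hB : BddBelow (Set.range fun σ1 : X => P2 σ1 σ2)) (σ1 : X) :
    flat2 P1 P2 σ1 σ2 ≤ P2 σ1 σ2 :=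
  flat1_le (P1 := fun y x => P2 x y) (P2 := fun y x => P1 x y) hB σ1

/-- If all best replies of player 2 to `σ1` give player 1 the same payoff, then the lower payoff
of player 1 at a best reply is the original payoff. -/
theorem flat1_eq_of_best_reply {X Y : Type} {P1 P2 : X → Y → ℝ} {σ1 : X} {σ2 : Y}
    (hmax : ∀ τ, P2 σ1 τ ≤ P2 σ1 σ2)
    (heq : ∀ τ, P2 σ1 τ = P2 σ1 σ2 → P1 σ1 τ = P1 σ1 σ2) :
    flat1 P1 P2 σ1 σ2 = P1 σ1 σ2 := by
  have hset : {v : ℝ | ∃ τ : Y, P2 σ1 σ2 ≤ P2 σ1 τ ∧ P1 σ1 τ = v} = {P1 σ1 σ2} := by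
    refine Set.eq_singleton_iff_unique_mem.2 ⟨⟨σ2, le_rfl, rfl⟩, ?_⟩
    rintro _ ⟨τ, hτ, rfl⟩
    exact heq τ ((hmax τ).antisymm hτ)
  rw [flat1, hset, csInf_singleton]

theorem flat2_eq_of_best_reply {X Y : Type} {P1 P2 : X → Y → ℝ} {σ1 : X} {σ2 : Y}
    (hmax : ∀ τ, P1 τ σ2 ≤ P1 σ1 σ2)
    (heq : ∀ τ, P1 τ σ2 = P1 σ1 σ2 → P2 τ σ2 = P2 σ1 σ2) :
    flat2 P1 P2 σ1 σ2 = P2 σ1 σ2 :=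
  flat1_eq_of_best_reply (P1 := fun y x => P2 x y) (P2 := fun y x => P1 x y) hmax heq

/-- A semi-strict Nash equilibrium of a game is a semi-strict Nash equilibrium of
its flat game. -/
theorem SSNE_flat {X Y : Type} [Nonempty X] [Nonempty Y]
    (P1 P2 : X → Y → ℝ)
    (hB1 : ∀ σ1 : X, BddBelow (Set.range fun σ2 : Y => P1 σ1 σ2))
    (hB2 : ∀ σ2 : Y, BddBelow (Set.range fun σ1 : X => P2 σ1 σ2))
    (s : X × Y) (hs : IsSSNE P1 P2 s) :
    IsSSNE (flat1 P1 P2) (flat2 P1 P2) s := by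
  obtain ⟨⟨hmax1, hmax2⟩, heq1, heq2⟩ := hs
  have h1 : flat1 P1 P2 s.1 s.2 = P1 s.1 s.2 := flat1_eq_of_best_reply hmax2 heq2
  have h2 : flat2 P1 P2 s.1 s.2 = P2 s.1 s.2 := flat2_eq_of_best_reply hmax1 heq1
  refine ⟨⟨fun σ1 => ?_, fun σ2 => ?_⟩, fun σ1 h => ?_, fun σ2 h => ?_⟩
  · rw [h1]
    exact (flat1_le (hB1 σ1) s.2).trans (hmax1 σ1)
  · rw [h2]
    exact (flat2_le (hB2 σ2) s.1).trans (hmax2 σ2)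
  · have hP : P1 σ1 s.2 = P1 s.1 s.2 :=
      (hmax1 σ1).antisymm (h1 ▸ h ▸ flat1_le (hB1 σ1) s.2)
    rw [flat2, flat2, hP]
  · have hP : P2 s.1 σ2 = P2 s.1 s.2 :=
      (hmax2 σ2).antisymm (h2 ▸ h ▸ flat2_le (hB2 σ2) s.1)
    rw [flat1, flat1, hP]
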